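/- Fix T, K > 0. There exist constants δ_0 > 0 and C such that for all 0 ≤ s < t ≤ T and all x, y satisfying |x| + |y| ≤ K and |x| ≤ δ_0: α q_1(x,y) = Ψ(0,0) − (1/2) u(q(s),s) y + (1/(2√(2πδ))) u(q(s),s) y² + R_1 and (1−α) q_2(x,y) = Ψ(0,0) + (1/2) u(q(s),s) y + (1/(2√(2πδ))) u(q(s),s) y² + R_2, where δ = t − s and both remainders satisfy |R_i| ≤ C( (|x| + |y|)(δ^{1/2} + |y| + δ^{-1/2}|y|²) + δ^{-3/2}|y|⁴ ). -/

import Mathlib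

open MeasureTheory Real Set Filter

/-- The Gaussian heat kernel `p(t,x,y) = (2πt)^{-1/2} exp(-(x-y)²/(2t))`. -/
noncomputable def heatKernel (t x y : ℝ) : ℝ :=
  (Real.sqrt (2 * Real.pi * t))⁻¹ * Real.exp (-(x - y) ^ 2 / (2 * t))

/-- The density `u(x,t)` of `B(t)`: `f` evolved by the heat semigroup. -/
noncomputable def udens (f : ℝ → ℝ) (x t : ℝ) : ℝ :=
  if t = 0 then f x else ∫ y : ℝ, heatKernel t x y * f y

/-- `Ψ(x,y) = P(B(t) > q(t) + x + y, B(s) < q(s) + x)` (for fixed `s < t`). -/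
noncomputable def bigPsi {Ω : Type*} [MeasurableSpace Ω] (P : Measure Ω)
    (B : ℝ → Ω → ℝ) (q : ℝ → ℝ) (s t x y : ℝ) : ℝ :=
  (P {ω | q t + x + y < B t ω ∧ B s ω < q s + x}).toReal

/-- `q₁(x,y) = P(B(t) > q(t) + x + y | B(s) < q(s) + x)`. -/
noncomputable def qOneB {Ω : Type*} [MeasurableSpace Ω] (P : Measure Ω)
    (B : ℝ → Ω → ℝ) (q : ℝ → ℝ) (s t x y : ℝ) : ℝ :=
  (P {ω | q t + x + y < B t ω ∧ B s ω < q s + x}).toReal /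
    (P {ω | B s ω < q s + x}).toReal

/-- `q₂(x,y) = P(B(t) < q(t) + x + y | B(s) > q(s) + x)`. -/
noncomputable def qTwoB {Ω : Type*} [MeasurableSpace Ω] (P : Measure Ω)
    (B : ℝ → Ω → ℝ) (q : ℝ → ℝ) (s t x y : ℝ) : ℝ :=
  (P {ω | B t ω < q t + x + y ∧ q s + x < B s ω}).toReal /
    (P {ω | q s + x < B s ω}).toReal

section

open ProbabilityTheory Topology

theorem abs_sub_le_of_hasDerivAt_of_abs_le {g g' : ℝ → ℝ} {C a b : ℝ}
    (hg : ∀ w ∈ uIcc a b, HasDerivAt g (g' w) w) (hC : ∀ w ∈ uIcc a b, |g' w| ≤ C) :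
    |g b - g a| ≤ C * |b - a| :=
  (convex_uIcc a b).norm_image_sub_le_of_norm_hasDerivWithin_le
    (fun w hw => (hg w hw).hasDerivWithinAt) hC left_mem_uIcc right_mem_uIcc

theorem abs_le_of_mem_uIcc_zero {a w : ℝ} (h : w ∈ uIcc 0 a) : |w| ≤ |a| := by
  simpa using abs_sub_left_of_mem_uIcc h

theorem integrable_id_stdGaussian : Integrable (fun z : ℝ => z) (gaussianReal 0 1) :=
  (memLp_id_gaussianReal 1).integrable (by norm_num)

theorem integrable_sq_stdGaussian : Integrable (fun z : ℝ => z ^ 2) (gaussianReal 0 1) :=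
  (memLp_id_gaussianReal 2).integrable_sq

theorem integral_sq_stdGaussian : ∫ z : ℝ, z ^ 2 ∂gaussianReal 0 1 = 1 := by
  have h := variance_fun_id_gaussianReal (μ := 0) (v := 1)
  rw [variance_of_integral_eq_zero (by fun_prop) (by simp)] at h
  simpa using h

theorem integral_abs_stdGaussian_le : ∫ z : ℝ, |z| ∂gaussianReal 0 1 ≤ 1 := by
  have h : ∫ z : ℝ, |z| ∂gaussianReal 0 1 ≤ ∫ z : ℝ, (1 + z ^ 2) / 2 ∂gaussianReal 0 1 := by
    refine integral_mono integrable_id_stdGaussian.abs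
      (((integrable_const 1).add integrable_sq_stdGaussian).div_const 2) fun z => ?_
    show |z| ≤ (1 + z ^ 2) / 2
    nlinarith [sq_nonneg (|z| - 1), sq_abs z]
  rw [integral_div, integral_add (integrable_const 1) integrable_sq_stdGaussian,
    integral_sq_stdGaussian] at h
  simpa using h

theorem heatKernel_eq_gaussianPDFReal {t : ℝ} (ht : 0 < t) (x y : ℝ) :
    heatKernel t x y = gaussianPDFReal x t.toNNReal y := by
  rw [heatKernel, gaussianPDFReal, Real.coe_toNNReal t ht.le]
  congr 3
  ring

theorem map_stdGaussian_affine {t : ℝ} (ht : 0 < t) (x : ℝ) :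
    (gaussianReal 0 1).map (fun z => x + √t * z) = gaussianReal x t.toNNReal := by
  have h := (Measure.map_map (measurable_const_add x) (measurable_const_mul (√t))
    (μ := gaussianReal 0 1)).symm
  rw [gaussianReal_map_const_mul, gaussianReal_map_const_add] at h
  have e : (NNReal.mk ((√t) ^ 2) (sq_nonneg _)) * 1 = t.toNNReal := by
    ext
    simp [Real.sq_sqrt ht.le, Real.coe_toNNReal t ht.le]
  rw [e] at h
  simpa [Function.comp_def] using h

theorem udens_eq_integral_stdGaussian {f : ℝ → ℝ} (hf : Continuous f) {t : ℝ} (ht : 0 ≤ t) (x : ℝ) :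
    udens f x t = ∫ z, f (x + √t * z) ∂gaussianReal 0 1 := by
  rcases ht.eq_or_lt with rfl | ht
  · simp [udens]
  · rw [udens, if_neg ht.ne']
    simp_rw [heatKernel_eq_gaussianPDFReal ht]
    rw [← integral_map (φ := fun z => x + √t * z) (f := f) (by fun_prop)
      hf.aestronglyMeasurable, map_stdGaussian_affine ht,
      integral_gaussianReal_eq_integral_smul (by simpa using ht)]
    rfl

theorem integral_Iic_heatKernel {t : ℝ} (ht : 0 < t) (x b : ℝ) :
    ∫ y in Iic b, heatKernel t x y
      = ∫ z, (Iic (b - √t * z)).indicator (fun _ => (1 : ℝ)) x ∂gaussianReal 0 1 := by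
  have h1 : ∫ y, (Iic b).indicator (fun _ => (1 : ℝ)) y ∂gaussianReal x t.toNNReal
      = ∫ y in Iic b, heatKernel t x y := by
    rw [integral_gaussianReal_eq_integral_smul (by simpa using ht),
      ← integral_indicator measurableSet_Iic]
    congr 1 with y
    by_cases hy : y ≤ b <;> simp [hy, heatKernel_eq_gaussianPDFReal ht]
  rw [← h1, ← map_stdGaussian_affine ht, integral_map (by fun_prop)
    (measurable_const.indicator measurableSet_Iic).aestronglyMeasurable]
  congr 1 with z
  simp only [indicator, mem_Iic, le_sub_iff_add_le]

theorem integrable_comp_stdGaussian {f : ℝ → ℝ} (hf : Continuous f) {M : ℝ} (hM : ∀ z, |f z| ≤ M)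
    (x c : ℝ) : Integrable (fun z => f (x + c * z)) (gaussianReal 0 1) :=
  Integrable.of_bound (by fun_prop) M (Eventually.of_forall fun z => hM _)

theorem abs_udens_le {f : ℝ → ℝ} (hf : Continuous f) {M : ℝ} (hM : ∀ z, |f z| ≤ M)
    {t : ℝ} (ht : 0 ≤ t) (x : ℝ) : |udens f x t| ≤ M := by
  rw [udens_eq_integral_stdGaussian hf ht]
  have h := norm_integral_le_of_norm_le_const (μ := gaussianReal 0 1)
    (f := fun z => f (x + √t * z)) (C := M) (Eventually.of_forall fun z => hM _)
  simpa using h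

theorem abs_udens_sub_le {f : ℝ → ℝ} (hf : Continuous f) {M L : ℝ} (hM : ∀ z, |f z| ≤ M)
    (hL : ∀ z w, |f z - f w| ≤ L * |z - w|) {s t : ℝ} (hs : 0 ≤ s) (hst : s ≤ t) (x y : ℝ) :
    |udens f x t - udens f y s| ≤ L * (|x - y| + √(t - s)) := by
  have hL0 : 0 ≤ L := by simpa using (abs_nonneg _).trans (hL 1 0)
  have hsqrt : √t - √s ≤ √(t - s) := by
    rw [sub_le_iff_le_add, Real.sqrt_le_iff]
    refine ⟨by positivity, ?_⟩
    nlinarith [Real.sq_sqrt hs, Real.sq_sqrt (sub_nonneg.2 hst),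
      mul_nonneg (Real.sqrt_nonneg (t - s)) (Real.sqrt_nonneg s)]
  have hsqrt' : 0 ≤ √t - √s := sub_nonneg.2 (Real.sqrt_le_sqrt hst)
  rw [udens_eq_integral_stdGaussian hf (hs.trans hst), udens_eq_integral_stdGaussian hf hs,
    ← integral_sub (integrable_comp_stdGaussian hf hM _ _) (integrable_comp_stdGaussian hf hM _ _)]
  have hi : Integrable (fun z : ℝ => L * |x - y| + L * √(t - s) * |z|) (gaussianReal 0 1) :=
    (integrable_const _).add (integrable_id_stdGaussian.abs.const_mul _)
  rw [← Real.norm_eq_abs]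
  refine (norm_integral_le_of_norm_le hi (Eventually.of_forall fun z => ?_)).trans ?_
  · refine (hL _ _).trans ?_
    rw [mul_assoc, ← mul_add]
    refine mul_le_mul_of_nonneg_left ?_ hL0
    have e : x + √t * z - (y + √s * z) = (x - y) + (√t - √s) * z := by ring
    rw [e]
    refine (abs_add_le _ _).trans ?_
    rw [abs_mul, abs_of_nonneg hsqrt']
    gcongr
  · rw [integral_add (integrable_const _) (integrable_id_stdGaussian.abs.const_mul _),
      integral_const_mul (L * √(t - s))]
    have := mul_le_mul_of_nonneg_left integral_abs_stdGaussian_le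
      (mul_nonneg hL0 (Real.sqrt_nonneg (t - s)))
    simp only [integral_const, probReal_univ, one_smul]
    linarith

theorem udens_pos {f : ℝ → ℝ} (hf : Continuous f) (hf0 : ∀ z, 0 ≤ f z) {M : ℝ}
    (hM : ∀ z, |f z| ≤ M) {y : ℝ} (hy : 0 < f y) {t : ℝ} (ht : 0 < t) (x : ℝ) :
    0 < udens f x t := by
  rw [udens_eq_integral_stdGaussian hf ht.le]
  have := (gaussianReal_absolutelyContinuous' 0 one_ne_zero).isOpenPosMeasure
  refine integral_pos_of_integrable_nonneg_nonzero (x := (y - x) / √t) (by fun_prop)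
    (integrable_comp_stdGaussian hf hM _ _) (fun z => hf0 _) ?_
  have : x + √t * ((y - x) / √t) = y := by
    have := (Real.sqrt_pos.2 ht).ne'
    field_simp
    ring
  simpa [this] using hy.ne'

theorem gaussianPDFReal_zero_one (z : ℝ) :
    gaussianPDFReal 0 1 z = (√(2 * π))⁻¹ * rexp (-(z ^ 2 / 2)) := by
  simp [gaussianPDFReal, neg_div]

theorem one_le_sqrt_two_pi : 1 ≤ √(2 * π) := by
  rw [Real.one_le_sqrt]
  linarith [Real.pi_gt_three]

theorem inv_sqrt_two_pi_le_one : (√(2 * π))⁻¹ ≤ 1 := inv_le_one_of_one_le₀ one_le_sqrt_two_pi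

theorem abs_gaussianPDFReal_zero_one_le (z : ℝ) : |gaussianPDFReal 0 1 z| ≤ 1 := by
  rw [abs_of_nonneg (gaussianPDFReal_nonneg _ _ _), gaussianPDFReal_zero_one]
  exact mul_le_one₀ inv_sqrt_two_pi_le_one (Real.exp_pos _).le
    (Real.exp_le_one_iff.2 (neg_nonpos.2 (by positivity)))

theorem abs_gaussianPDFReal_zero_one_sub_le (z : ℝ) :
    |gaussianPDFReal 0 1 z - (√(2 * π))⁻¹| ≤ z ^ 2 := by
  have h1 : rexp (-(z ^ 2 / 2)) ≤ 1 := Real.exp_le_one_iff.2 (neg_nonpos.2 (by positivity))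
  have h2 := Real.add_one_le_exp (-(z ^ 2 / 2))
  have e : gaussianPDFReal 0 1 z - (√(2 * π))⁻¹
      = (√(2 * π))⁻¹ * (rexp (-(z ^ 2 / 2)) - 1) := by
    rw [gaussianPDFReal_zero_one]
    ring
  rw [e, abs_mul, abs_of_nonneg (by positivity), abs_of_nonpos (by linarith)]
  calc (√(2 * π))⁻¹ * -(rexp (-(z ^ 2 / 2)) - 1)
      ≤ 1 * (z ^ 2) := mul_le_mul inv_sqrt_two_pi_le_one (by nlinarith [sq_nonneg z])
        (by linarith) zero_le_one
    _ = z ^ 2 := one_mul _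

theorem continuous_gaussianPDFReal_zero_one : Continuous (gaussianPDFReal 0 1) := by
  unfold gaussianPDFReal
  fun_prop

theorem hasDerivAt_gaussianPDFReal_zero_one (z : ℝ) :
    HasDerivAt (gaussianPDFReal 0 1) (-(z * gaussianPDFReal 0 1 z)) z := by
  have h : HasDerivAt (fun z : ℝ => (√(2 * π))⁻¹ * rexp (-(z ^ 2 / 2)))
      ((√(2 * π))⁻¹ * (rexp (-(z ^ 2 / 2)) * -(2 * z / 2))) z := by
    have := ((((hasDerivAt_id z).pow 2).div_const 2).neg.exp).const_mul ((√(2 * π))⁻¹)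
    simpa using this
  rw [show gaussianPDFReal 0 1 = _ from funext gaussianPDFReal_zero_one]
  convert h using 1
  ring

theorem tendsto_gaussianPDFReal_zero_one : Tendsto (gaussianPDFReal 0 1) atTop (𝓝 0) := by
  rw [show gaussianPDFReal 0 1 = _ from funext gaussianPDFReal_zero_one]
  have h : Tendsto (fun z : ℝ => rexp (-(z ^ 2 / 2))) atTop (𝓝 0) :=
    Real.tendsto_exp_neg_atTop_nhds_zero.comp
      ((tendsto_pow_atTop two_ne_zero).atTop_div_const two_pos)
  simpa using h.const_mul (√(2 * π))⁻¹

/-- The upper tail `P(N > a)` of a standard Gaussian variable. -/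
noncomputable def gaussianTail (a : ℝ) : ℝ := 1 / 2 - ∫ z in (0 : ℝ)..a, gaussianPDFReal 0 1 z

theorem hasDerivAt_gaussianTail (a : ℝ) : HasDerivAt gaussianTail (-gaussianPDFReal 0 1 a) a :=
  (intervalIntegral.integral_hasDerivAt_right
    (continuous_gaussianPDFReal_zero_one.intervalIntegrable _ _)
    (continuous_gaussianPDFReal_zero_one.stronglyMeasurableAtFilter _ _)
    continuous_gaussianPDFReal_zero_one.continuousAt).const_sub _

theorem tendsto_gaussianTail : Tendsto gaussianTail atTop (𝓝 0) := by
  have h : ∫ z in Ioi (0 : ℝ), gaussianPDFReal 0 1 z = 1 / 2 := by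
    simp_rw [gaussianPDFReal_zero_one]
    have e : ∀ z : ℝ, -(z ^ 2 / 2) = -(1 / 2) * z ^ 2 := fun z => by ring
    simp_rw [e]
    rw [integral_const_mul, integral_gaussian_Ioi, show π / (1 / 2) = 2 * π by ring]
    have := one_le_sqrt_two_pi
    field_simp
  have h2 := (intervalIntegral_tendsto_integral_Ioi 0
    (integrable_gaussianPDFReal 0 1).integrableOn tendsto_id).const_sub (1 / 2)
  rw [h, sub_self] at h2
  exact h2

/-- The expected positive part `E (N - a)⁺` of a standard Gaussian variable. -/
noncomputable def gaussianExcess (a : ℝ) : ℝ := ∫ z, max (z - a) 0 ∂gaussianReal 0 1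

theorem gaussianExcess_eq (a : ℝ) :
    gaussianExcess a = gaussianPDFReal 0 1 a - a * gaussianTail a := by
  have h1 : gaussianExcess a = ∫ z in Ioi a, gaussianPDFReal 0 1 z * (z - a) := by
    rw [gaussianExcess, integral_gaussianReal_eq_integral_smul one_ne_zero,
      ← integral_indicator measurableSet_Ioi]
    congr 1 with z
    by_cases hz : a < z
    · simp [hz, hz.le]
    · simp [hz, not_lt.1 hz]
  rw [h1, integral_Ioi_of_hasDerivAt_of_nonneg'
    (g := fun z => -gaussianPDFReal 0 1 z + a * gaussianTail z) (l := 0)]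
  · ring
  · intro z _
    exact ((hasDerivAt_gaussianPDFReal_zero_one z).neg.add
      ((hasDerivAt_gaussianTail z).const_mul a)).congr_deriv (by ring)
  · exact fun z hz => mul_nonneg (gaussianPDFReal_nonneg _ _ _) (sub_nonneg.2 (le_of_lt hz))
  · simpa using tendsto_gaussianPDFReal_zero_one.neg.add (tendsto_gaussianTail.const_mul a)

theorem hasDerivAt_gaussianExcess (a : ℝ) : HasDerivAt gaussianExcess (-gaussianTail a) a := by
  rw [show gaussianExcess = _ from funext gaussianExcess_eq]
  exact ((hasDerivAt_gaussianPDFReal_zero_one a).sub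
    ((hasDerivAt_id' a).mul (hasDerivAt_gaussianTail a))).congr_deriv (by ring)

theorem abs_gaussianExcess_mixed_difference_le (a d : ℝ) :
    |gaussianExcess (a + d) - gaussianExcess d - (gaussianExcess a - gaussianExcess 0)|
      ≤ |a| * |d| := by
  have h := abs_sub_le_of_hasDerivAt_of_abs_le (a := 0) (b := a) (C := |d|)
    (g := fun w => gaussianExcess (w + d) - gaussianExcess w)
    (fun w _ => (HasDerivAt.comp_add_const w d (hasDerivAt_gaussianExcess (w + d))).sub
      (hasDerivAt_gaussianExcess w))
    (fun w _ => by
      have h := abs_sub_le_of_hasDerivAt_of_abs_le (a := w) (b := w + d) (C := 1)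
        (fun v _ => hasDerivAt_gaussianTail v)
        (fun v _ => by simpa using abs_gaussianPDFReal_zero_one_le v)
      rw [abs_sub_comm] at h
      simpa [neg_add_eq_sub] using h)
  rw [zero_add, sub_zero, mul_comm] at h
  convert h using 2
  ring

theorem abs_gaussianExcess_sub_taylor_le (a : ℝ) :
    |gaussianExcess a - gaussianExcess 0 - (-(1 / 2) * a + 1 / (2 * √(2 * π)) * a ^ 2)|
      ≤ |a| ^ 4 := by
  have hk : ∀ w, |1 / 2 - gaussianTail w - (√(2 * π))⁻¹ * w| ≤ |w| ^ 3 := fun w => by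
    have h := abs_sub_le_of_hasDerivAt_of_abs_le (a := 0) (b := w) (C := |w| ^ 2)
      (g := fun v => 1 / 2 - gaussianTail v - (√(2 * π))⁻¹ * v)
      (fun v _ => ((hasDerivAt_gaussianTail v).const_sub _).sub
        ((hasDerivAt_id v).const_mul _))
      (fun v hv => by
        have h1 := abs_gaussianPDFReal_zero_one_sub_le v
        have h2 : v ^ 2 ≤ |w| ^ 2 := by
          rw [← sq_abs v]
          exact pow_le_pow_left₀ (abs_nonneg v) (abs_le_of_mem_uIcc_zero hv) 2
        simpa using h1.trans h2)
    simp only [gaussianTail, intervalIntegral.integral_same, sub_zero, mul_zero, sub_self] at h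
    rw [← pow_succ] at h
    exact h
  have h := abs_sub_le_of_hasDerivAt_of_abs_le (a := 0) (b := a) (C := |a| ^ 3)
    (g := fun v => gaussianExcess v - (-(1 / 2) * v + 1 / (2 * √(2 * π)) * v ^ 2))
    (g' := fun v => 1 / 2 - gaussianTail v - (√(2 * π))⁻¹ * v)
    (fun v _ => by
      have h0 := (zero_lt_one.trans_le one_le_sqrt_two_pi).ne'
      refine ((hasDerivAt_gaussianExcess v).sub (((hasDerivAt_id' v).const_mul (-(1 / 2))).add
        (((hasDerivAt_id' v).pow 2).const_mul (1 / (2 * √(2 * π)))))).congr_deriv ?_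
      field_simp
      ring)
    (fun v hv => (hk v).trans 
      (pow_le_pow_left₀ (abs_nonneg v) (abs_le_of_mem_uIcc_zero hv) 3))
  rw [sub_zero, ← pow_succ] at h
  convert h using 2
  ring

theorem abs_increment_sub_increment_le {F u : ℝ → ℝ} {L : ℝ} (hF : ∀ z, HasDerivAt F (u z) z)
    (hL : ∀ z w, |u z - u w| ≤ L * |z - w|) (r x : ℝ) {c d : ℝ} (hc : 0 ≤ c) (hd : 0 ≤ d) :
    |F (r + x) - F (r + x - d) - (F r - F (r - c)) - u r * (d - c)|
      ≤ L * |x| * d + L * |d - c| * (c + d) := by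
  have hL0 : 0 ≤ L := by simpa using (abs_nonneg _).trans (hL 1 0)
  have h1 := abs_sub_le_of_hasDerivAt_of_abs_le (a := 0) (b := x) (C := L * d)
    (g := fun w => F (r + w) - F (r + w - d)) (g' := fun w => u (r + w) - u (r + w - d))
    (fun w _ => ((hF (r + w)).comp_const_add r w).sub
      (((hF (r + w - d)).comp_sub_const (r + w) d).comp_const_add r w))
    (fun w _ => by simpa [abs_of_nonneg hd] using hL (r + w) (r + w - d))
  have h2 := abs_sub_le_of_hasDerivAt_of_abs_le (a := c) (b := d) (C := L * (c + d))
    (g := fun w => -F (r - w) - u r * w) (g' := fun w => u (r - w) - u r)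
    (fun w _ => by
      exact (((hF (r - w)).comp_const_sub r w).neg.sub
        ((hasDerivAt_id' w).const_mul (u r))).congr_deriv (by ring))
    (fun w hw => by
      refine (hL _ _).trans (mul_le_mul_of_nonneg_left ?_ hL0)
      rw [mem_uIcc] at hw
      rw [sub_sub_cancel_left, abs_neg, abs_le]
      constructor <;> rcases hw with hw | hw <;> linarith)
  simp only [add_zero, sub_zero] at h1
  have e : F (r + x) - F (r + x - d) - (F r - F (r - c)) - u r * (d - c)
      = F (r + x) - F (r + x - d) - (F r - F (r - d))
        + (-F (r - d) - u r * d - (-F (r - c) - u r * c)) := by ring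
  rw [e]
  refine (abs_add_le _ _).trans ?_
  linarith

theorem max_mul_sub_eq {e : ℝ} (he : 0 < e) (y z : ℝ) :
    max (e * z - y) 0 = e * max (z - y / e) 0 := by
  rw [mul_max_of_nonneg _ _ he.le, mul_zero, mul_sub, mul_div_cancel₀ _ he.ne']

theorem integrable_max_stdGaussian (e y : ℝ) :
    Integrable (fun z : ℝ => max (e * z - y) 0) (gaussianReal 0 1) :=
  ((integrable_id_stdGaussian.const_mul e).sub (integrable_const y)).pos_part

theorem integral_max_stdGaussian {e : ℝ} (he : 0 < e) (y : ℝ) :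
    ∫ z, max (e * z - y) 0 ∂gaussianReal 0 1 = e * gaussianExcess (y / e) := by
  simp_rw [max_mul_sub_eq he, integral_const_mul]
  rfl

theorem max_mul_sub_le {e : ℝ} (he : 0 < e) (y z : ℝ) : max (e * z - y) 0 ≤ e * |z| + |y| :=
  max_le (by nlinarith [le_abs_self z, neg_abs_le y]) (by positivity)

theorem integral_max_stdGaussian_le {e : ℝ} (he : 0 < e) (y : ℝ) :
    ∫ z, max (e * z - y) 0 ∂gaussianReal 0 1 ≤ e + |y| := by
  refine (integral_mono (integrable_max_stdGaussian e y)
    ((integrable_id_stdGaussian.abs.const_mul e).add (integrable_const |y|))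
    (max_mul_sub_le he y)).trans ?_
  rw [integral_add' (integrable_id_stdGaussian.abs.const_mul e) (integrable_const |y|),
    integral_const_mul]
  simpa using mul_le_mul_of_nonneg_left integral_abs_stdGaussian_le he.le

theorem abs_integral_max_sub_taylor_le {e : ℝ} (he : 0 < e) (y d : ℝ) :
    |∫ z, max (e * z - (y + d)) 0 ∂gaussianReal 0 1 - ∫ z, max (e * z - d) 0 ∂gaussianReal 0 1
        - (-(1 / 2) * y + 1 / (2 * (√(2 * π) * e)) * y ^ 2)|
      ≤ |y| * |d| / e + |y| ^ 4 / e ^ 3 := by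
  have h1 := abs_gaussianExcess_mixed_difference_le (y / e) (d / e)
  have h2 := abs_gaussianExcess_sub_taylor_le (y / e)
  have h0 := (zero_lt_one.trans_le one_le_sqrt_two_pi).ne'
  rw [integral_max_stdGaussian he, integral_max_stdGaussian he, add_div]
  set A := gaussianExcess (y / e + d / e) - gaussianExcess (d / e)
    - (gaussianExcess (y / e) - gaussianExcess 0)
  set D := gaussianExcess (y / e) - gaussianExcess 0
    - (-(1 / 2) * (y / e) + 1 / (2 * √(2 * π)) * (y / e) ^ 2) with hD
  have e1 : e * gaussianExcess (y / e + d / e) - e * gaussianExcess (d / e)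
      - (-(1 / 2) * y + 1 / (2 * (√(2 * π) * e)) * y ^ 2) = e * A + e * D := by
    have : e * (-(1 / 2) * (y / e) + 1 / (2 * √(2 * π)) * (y / e) ^ 2)
        = -(1 / 2) * y + 1 / (2 * (√(2 * π) * e)) * y ^ 2 := by field_simp
    rw [← this, hD]
    ring
  rw [e1]
  refine (abs_add_le _ _).trans (add_le_add ?_ ?_)
  · rw [abs_mul, abs_of_pos he]
    refine (mul_le_mul_of_nonneg_left h1 he.le).trans_eq ?_
    rw [abs_div, abs_div, abs_of_pos he]
    field_simp
  · rw [abs_mul, abs_of_pos he]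
    refine (mul_le_mul_of_nonneg_left h2 he.le).trans_eq ?_
    rw [abs_div, abs_of_pos he]
    field_simp

/-- The probability `P(X < r, X + e N > r + y)` when `X` has distribution function `F`
and `N` is an independent standard Gaussian variable. -/
noncomputable def crossing (F : ℝ → ℝ) (e r y : ℝ) : ℝ :=
  ∫ z, (F r - F (r - max (e * z - y) 0)) ∂gaussianReal 0 1

theorem integrable_crossing {F : ℝ → ℝ} (hFc : Continuous F) (hF1 : ∀ z, |F z| ≤ 1)
    (e r y : ℝ) :
    Integrable (fun z => F r - F (r - max (e * z - y) 0)) (gaussianReal 0 1) :=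
  (integrable_const _).sub
    (Integrable.of_bound (by fun_prop) 1 (Eventually.of_forall fun z => hF1 _))

theorem crossing_le {F u : ℝ → ℝ} {M : ℝ} (hF : ∀ z, HasDerivAt F (u z) z)
    (hF1 : ∀ z, |F z| ≤ 1) (hM : ∀ z, |u z| ≤ M) {e : ℝ} (he : 0 < e) (r y : ℝ) :
    crossing F e r y ≤ M * (e + |y|) := by
  have hM0 : 0 ≤ M := (abs_nonneg _).trans (hM 0)
  have hFc : Continuous F := continuous_iff_continuousAt.2 fun z => (hF z).continuousAt
  refine (integral_mono (integrable_crossing hFc hF1 e r y)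
    ((integrable_max_stdGaussian e y).const_mul M) fun z => ?_).trans ?_
  · have h := abs_sub_le_of_hasDerivAt_of_abs_le (a := r - max (e * z - y) 0) (b := r)
      (fun w _ => hF w) (fun w _ => hM w)
    rw [sub_sub_cancel, abs_of_nonneg (le_max_right (e * z - y) 0)] at h
    exact (le_abs_self _).trans h
  · rw [integral_const_mul]
    exact mul_le_mul_of_nonneg_left (integral_max_stdGaussian_le he y) hM0

theorem abs_crossing_sub_crossing_le {F u : ℝ → ℝ} {L : ℝ} (hF : ∀ z, HasDerivAt F (u z) z)
    (hF1 : ∀ z, |F z| ≤ 1) (hL : ∀ z w, |u z - u w| ≤ L * |z - w|) {e : ℝ} (he : 0 < e)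
    (r x y d : ℝ) :
    |crossing F e (r + x) (y + d) - crossing F e r d
        - u r * (∫ z, max (e * z - (y + d)) 0 ∂gaussianReal 0 1
          - ∫ z, max (e * z - d) 0 ∂gaussianReal 0 1)|
      ≤ 2 * L * (|x| + |y|) * (e + |y| + |d|) := by
  have hL0 : 0 ≤ L := by simpa using (abs_nonneg _).trans (hL 1 0)
  have hFc : Continuous F := continuous_iff_continuousAt.2 fun z => (hF z).continuousAt
  have i1 := integrable_crossing hFc hF1 e (r + x) (y + d)
  have i2 := integrable_crossing hFc hF1 e r d
  have j1 := integrable_max_stdGaussian e (y + d)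
  have j2 := integrable_max_stdGaussian e d
  have i3 : Integrable (fun z : ℝ => L * (|x| + |y|) * max (e * z - (y + d)) 0
      + L * |y| * max (e * z - d) 0) (gaussianReal 0 1) :=
    (j1.const_mul (L * (|x| + |y|))).add (j2.const_mul (L * |y|))
  have i4 : Integrable (fun z => F (r + x) - F (r + x - max (e * z - (y + d)) 0)
      - (F r - F (r - max (e * z - d) 0))) (gaussianReal 0 1) := i1.sub i2
  have j3 : Integrable (fun z => u r * (max (e * z - (y + d)) 0 - max (e * z - d) 0))
      (gaussianReal 0 1) := (j1.sub j2).const_mul _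
  rw [crossing, crossing, ← integral_sub i1 i2, ← integral_sub j1 j2, ← integral_const_mul,
    ← integral_sub i4 j3, ← Real.norm_eq_abs]
  refine (norm_integral_le_of_norm_le i3 (Eventually.of_forall fun z => ?_)).trans ?_
  · have hc := le_max_right (e * z - d) 0
    have hd := le_max_right (e * z - (y + d)) 0
    refine (abs_increment_sub_increment_le hF hL r x hc hd).trans ?_
    have h1 : |max (e * z - (y + d)) 0 - max (e * z - d) 0| ≤ |y| := by
      refine (abs_max_sub_max_le_abs _ _ _).trans_eq ?_
      rw [show e * z - (y + d) - (e * z - d) = -y by ring, abs_neg]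
    have h2 := mul_le_mul_of_nonneg_right (mul_le_mul_of_nonneg_left h1 hL0) (add_nonneg hc hd)
    linarith
  · rw [integral_add (j1.const_mul _) (j2.const_mul _), integral_const_mul, integral_const_mul]
    have h1 := integral_max_stdGaussian_le he (y + d)
    have h2 := integral_max_stdGaussian_le he d
    have h3 : ∫ z, max (e * z - (y + d)) 0 ∂gaussianReal 0 1 ≤ e + |y| + |d| := by
      linarith [abs_add_le y d]
    have h4 : ∫ z, max (e * z - d) 0 ∂gaussianReal 0 1 ≤ e + |y| + |d| := by
      linarith [abs_nonneg y]
    have h5 := mul_le_mul_of_nonneg_left h3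
      (mul_nonneg hL0 (add_nonneg (abs_nonneg x) (abs_nonneg y)))
    have h6 := mul_le_mul_of_nonneg_left h4 (mul_nonneg hL0 (abs_nonneg y))
    have h7 : 0 ≤ L * |x| * (e + |y| + |d|) := by positivity
    linarith

theorem abs_crossing_sub_taylor_le {F u : ℝ → ℝ} {M L κ E : ℝ}
    (hF : ∀ z, HasDerivAt F (u z) z) (hF1 : ∀ z, |F z| ≤ 1) (hM : ∀ z, |u z| ≤ M)
    (hL : ∀ z w, |u z - u w| ≤ L * |z - w|) (hκ : 0 ≤ κ) {e d : ℝ} (he : 0 < e) (heE : e ≤ E)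
    (hd : |d| ≤ κ * e ^ 2) (r x y : ℝ) :
    |crossing F e (r + x) (y + d)
        - (crossing F e r d + u r * (-(1 / 2) * y + 1 / (2 * (√(2 * π) * e)) * y ^ 2))|
      ≤ (2 * L * (1 + κ * E) + M * κ + M) * ((|x| + |y|) * (e + |y|) + |y| ^ 4 / e ^ 3) := by
  have hL0 : 0 ≤ L := by simpa using (abs_nonneg _).trans (hL 1 0)
  have hM0 : 0 ≤ M := (abs_nonneg _).trans (hM 0)
  have hE : 0 ≤ E := he.le.trans heE
  have h1 := abs_crossing_sub_crossing_le hF hF1 hL he r x y d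
  have h2 := abs_integral_max_sub_taylor_le he y d
  set D := ∫ z, max (e * z - (y + d)) 0 ∂gaussianReal 0 1
    - ∫ z, max (e * z - d) 0 ∂gaussianReal 0 1
  set p := -(1 / 2) * y + 1 / (2 * (√(2 * π) * e)) * y ^ 2
  have e1 : crossing F e (r + x) (y + d) - (crossing F e r d + u r * p)
      = (crossing F e (r + x) (y + d) - crossing F e r d - u r * D) + u r * (D - p) := by ring
  have h3 : |u r * (D - p)| ≤ M * (|y| * |d| / e + |y| ^ 4 / e ^ 3) := by
    rw [abs_mul]
    exact mul_le_mul (hM r) h2 (abs_nonneg _) hM0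
  have h4 : |y| * |d| / e ≤ κ * (|y| * e) := by
    rw [div_le_iff₀ he]
    nlinarith [mul_le_mul_of_nonneg_left hd (abs_nonneg y)]
  have h5 : |d| ≤ κ * E * e := by
    nlinarith [mul_le_mul_of_nonneg_left heE (mul_nonneg hκ he.le)]
  rw [e1]
  refine (abs_add_le _ _).trans ((add_le_add h1 h3).trans ?_)
  have hq : 0 ≤ |y| ^ 4 / e ^ 3 := by positivity
  have hs : 0 ≤ |x| + |y| := by positivity
  have h6 : 2 * L * (|x| + |y|) * (e + |y| + |d|)
      ≤ 2 * L * (1 + κ * E) * ((|x| + |y|) * (e + |y|)) := by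
    have : e + |y| + |d| ≤ (1 + κ * E) * (e + |y|) := by
      nlinarith [mul_nonneg (mul_nonneg hκ hE) (abs_nonneg y)]
    nlinarith [mul_le_mul_of_nonneg_left this (mul_nonneg (mul_nonneg zero_le_two hL0) hs)]
  have h7 : |y| * e ≤ (|x| + |y|) * (e + |y|) := by
    nlinarith [mul_nonneg (abs_nonneg x) he.le, mul_nonneg (abs_nonneg x) (abs_nonneg y),
      mul_nonneg (abs_nonneg y) (abs_nonneg y)]
  have h8 : M * (|y| * |d| / e + |y| ^ 4 / e ^ 3)
      ≤ M * κ * ((|x| + |y|) * (e + |y|)) + M * (|y| ^ 4 / e ^ 3) := by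
    rw [mul_add, mul_assoc M κ]
    gcongr
    exact h4.trans (mul_le_mul_of_nonneg_left h7 hκ)
  have h9 : 0 ≤ (2 * L * (1 + κ * E) + M * κ) * (|y| ^ 4 / e ^ 3) := by positivity
  have h10 : 0 ≤ M * ((|x| + |y|) * (e + |y|)) := by positivity
  linarith

theorem integral_Iic_heatKernel_mul {u : ℝ → ℝ} (hu : ∀ a, IntegrableOn u (Iic a)) {t : ℝ}
    (ht : 0 < t) (a b : ℝ) :
    ∫ x in Iic a, (∫ y in Iic b, heatKernel t x y) * u x
      = ∫ z, (∫ x in Iic (min a (b - √t * z)), u x) ∂gaussianReal 0 1 := by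
  have hi : Integrable (Function.uncurry fun x z : ℝ => (Iic (b - √t * z)).indicator u x)
      ((volume.restrict (Iic a)).prod (gaussianReal 0 1)) := by
    have hS : MeasurableSet {p : ℝ × ℝ | p.1 ≤ b - √t * p.2} :=
      measurableSet_le (by fun_prop) (by fun_prop)
    have h : Integrable (fun p : ℝ × ℝ => u p.1)
        ((volume.restrict (Iic a)).prod (gaussianReal 0 1)) :=
      Integrable.comp_fst (hu a) (gaussianReal 0 1)
    exact h.indicator hS
  have h1 : ∀ x, (∫ y in Iic b, heatKernel t x y) * u x
      = ∫ z, (Iic (b - √t * z)).indicator u x ∂gaussianReal 0 1 := fun x => by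
    rw [integral_Iic_heatKernel ht, ← integral_mul_const]
    congr 1 with z
    by_cases hz : x ≤ b - √t * z <;> simp [hz]
  simp_rw [h1]
  rw [integral_integral_swap hi]
  congr 1 with z
  rw [integral_indicator measurableSet_Iic, Measure.restrict_restrict measurableSet_Iic,
    Iic_inter_Iic, inf_comm]

section Law

variable {Ω : Type*} [MeasurableSpace Ω] {P : Measure Ω} [IsProbabilityMeasure P]
  {X Y : Ω → ℝ} {F G : ℝ → ℝ}

theorem ae_ne_of_continuous_distribution (hX : Measurable X)
    (hF : ∀ a, (P {ω | X ω ≤ a}).toReal = F a) (hFc : Continuous F) (a : ℝ) :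
    ∀ᵐ ω ∂P, X ω ≠ a := by
  have hle : ∀ b < a, P.real {ω | X ω = a} ≤ F a - F b := fun b hb => by
    rw [← hF a, ← hF b]
    have h := measureReal_sdiff (μ := P) (s₁ := {ω | X ω ≤ a}) (s₂ := {ω | X ω ≤ b})
      (fun ω (hω : X ω ≤ b) => hω.trans hb.le) (measurableSet_le hX measurable_const)
    refine le_trans ?_ h.le
    exact measureReal_mono fun ω (hω : X ω = a) => ⟨hω.le, by simpa [hω] using hb⟩
  have ht : Tendsto (fun b => F a - F b) (𝓝[<] a) (𝓝 0) := by
    have h : Tendsto (fun b => F a - F b) (𝓝 a) (𝓝 (F a - F a)) := by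
      exact (continuous_const.sub hFc).tendsto a
    rw [sub_self] at h
    exact h.mono_left nhdsWithin_le_nhds
  have h0 : P.real {ω | X ω = a} ≤ 0 :=
    ge_of_tendsto ht (eventually_nhdsWithin_of_forall fun b hb => hle b hb)
  have h1 : P {ω | X ω = a} = 0 :=
    (measureReal_eq_zero_iff).1 (le_antisymm h0 measureReal_nonneg)
  simpa [ae_iff] using h1

theorem measure_lt_eq (hX : Measurable X) (hF : ∀ a, (P {ω | X ω ≤ a}).toReal = F a)
    (hFc : Continuous F) (a : ℝ) : (P {ω | X ω < a}).toReal = F a := by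
  rw [← hF a]
  congr 1
  refine measure_congr ?_
  filter_upwards [ae_ne_of_continuous_distribution hX hF hFc a] with ω hω
  exact propext ⟨le_of_lt, fun h => lt_of_le_of_ne h hω⟩

theorem measure_gt_eq (hX : Measurable X) (hF : ∀ a, (P {ω | X ω ≤ a}).toReal = F a) (a : ℝ) :
    (P {ω | a < X ω}).toReal = 1 - F a := by
  have h := probReal_compl_eq_one_sub (μ := P) (measurableSet_le hX (measurable_const (a := a)))
  rw [← hF a]
  rw [Measure.real, Measure.real] at h
  rw [← h]
  congr 2 with ω
  simp

theorem measure_up_crossing_eq (hX : Measurable X) (hY : Measurable Y)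
    (hF : ∀ a, (P {ω | X ω ≤ a}).toReal = F a) (hFc : Continuous F) (a b : ℝ) :
    (P {ω | b < Y ω ∧ X ω < a}).toReal = F a - (P {ω | X ω ≤ a ∧ Y ω ≤ b}).toReal := by
  have h := measureReal_sdiff (μ := P) (s₁ := {ω | X ω ≤ a}) (s₂ := {ω | X ω ≤ a ∧ Y ω ≤ b})
    (fun ω hω => hω.1)
    ((measurableSet_le hX measurable_const).inter (measurableSet_le hY measurable_const))
  rw [← hF a]
  refine Eq.trans ?_ h
  refine congrArg ENNReal.toReal (measure_congr ?_)
  filter_upwards [ae_ne_of_continuous_distribution hX hF hFc a] with ω hω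
  refine propext ⟨fun h => ⟨h.2.le, fun h' => absurd h'.2 (not_le.2 h.1)⟩, fun h => ?_⟩
  exact ⟨not_le.1 fun h' => h.2 ⟨h.1, h'⟩, lt_of_le_of_ne h.1 hω⟩

theorem measure_down_crossing_eq (hX : Measurable X) (hY : Measurable Y)
    (hG : ∀ a, (P {ω | Y ω ≤ a}).toReal = G a) (hGc : Continuous G) (a b : ℝ) :
    (P {ω | Y ω < b ∧ a < X ω}).toReal = G b - (P {ω | X ω ≤ a ∧ Y ω ≤ b}).toReal := by
  have h := measureReal_sdiff (μ := P) (s₁ := {ω | Y ω ≤ b}) (s₂ := {ω | X ω ≤ a ∧ Y ω ≤ b})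
    (fun ω hω => hω.2)
    ((measurableSet_le hX measurable_const).inter (measurableSet_le hY measurable_const))
  rw [← hG b]
  refine Eq.trans ?_ h
  refine congrArg ENNReal.toReal (measure_congr ?_)
  filter_upwards [ae_ne_of_continuous_distribution hY hG hGc b] with ω hω
  refine propext ⟨fun h => ⟨h.1.le, fun h' => absurd h'.1 (not_le.2 h.2)⟩, fun h => ?_⟩
  exact ⟨lt_of_le_of_ne h.1 hω, not_le.1 fun h' => h.2 ⟨h', h.1⟩⟩

theorem tendsto_distribution_atTop (hX : Measurable X)
    (hF : ∀ a, (P {ω | X ω ≤ a}).toReal = F a) : Tendsto F atTop (𝓝 1) := by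
  have : IsProbabilityMeasure (P.map X) := Measure.isProbabilityMeasure_map hX.aemeasurable
  have h := tendsto_cdf_atTop (P.map X)
  refine h.congr fun a => ?_
  rw [cdf_eq_real, map_measureReal_apply hX measurableSet_Iic, ← hF a]
  rfl

theorem distribution_monotone (hF : ∀ a, (P {ω | X ω ≤ a}).toReal = F a) : Monotone F :=
  fun a b hab => by
    rw [← hF a, ← hF b]
    exact measureReal_mono fun ω (hω : X ω ≤ a) => hω.trans hab

theorem abs_distribution_le_one (hF : ∀ a, (P {ω | X ω ≤ a}).toReal = F a) (a : ℝ) :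
    |F a| ≤ 1 := by
  rw [← hF a, abs_of_nonneg ENNReal.toReal_nonneg]
  exact measureReal_le_one

theorem distribution_sub_integral_eq_crossing {F : ℝ → ℝ} (hFc : Continuous F)
    (hF1 : ∀ z, |F z| ≤ 1) (e a b : ℝ) :
    F a - ∫ z, F (min a (b - e * z)) ∂gaussianReal 0 1 = crossing F e a (b - a) := by
  rw [crossing, integral_sub (integrable_const _)
    (Integrable.of_bound (by fun_prop) 1 (Eventually.of_forall fun z => hF1 _))]
  have h : ∀ z, a - max (e * z - (b - a)) 0 = min a (b - e * z) := fun z => by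
    rcases le_total (e * z) (b - a) with h | h
    · rw [max_eq_right (by linarith), min_eq_left (by linarith), sub_zero]
    · rw [max_eq_left (by linarith), min_eq_right (by linarith)]
      ring
  simp [h]

theorem distribution_eq_integral (hX : Measurable X) (hY : Measurable Y)
    (hF : ∀ a, (P {ω | X ω ≤ a}).toReal = F a) (hFc : Continuous F)
    (hG : ∀ a, (P {ω | Y ω ≤ a}).toReal = G a) (e b : ℝ)
    (hJ : ∀ a, (P {ω | X ω ≤ a ∧ Y ω ≤ b}).toReal
      = ∫ z, F (min a (b - e * z)) ∂gaussianReal 0 1) :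
    G b = ∫ z, F (b - e * z) ∂gaussianReal 0 1 := by
  have hF1 := abs_distribution_le_one hF
  have h1 : Tendsto (fun a => ∫ z, F (min a (b - e * z)) ∂gaussianReal 0 1) atTop
      (𝓝 (∫ z, F (b - e * z) ∂gaussianReal 0 1)) := by
    refine tendsto_integral_filter_of_dominated_convergence (fun _ => 1)
      (Eventually.of_forall fun a => by fun_prop)
      (Eventually.of_forall fun a => Eventually.of_forall fun z => hF1 _)
      (integrable_const _) (Eventually.of_forall fun z => ?_)
    refine tendsto_const_nhds.congr' ?_
    filter_upwards [eventually_ge_atTop (b - e * z)] with a ha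
    rw [min_eq_right ha]
  have h2 : Tendsto (fun a => ∫ z, F (min a (b - e * z)) ∂gaussianReal 0 1) atTop
      (𝓝 (G b)) := by
    refine tendsto_of_tendsto_of_tendsto_of_le_of_le (g := fun a => G b - (1 - F a))
      (h := fun _ => G b) ?_ tendsto_const_nhds (fun a => ?_) (fun a => ?_)
    · simpa using ((tendsto_distribution_atTop hX hF).const_sub 1).const_sub (G b)
    · have h := measureReal_sdiff (μ := P) (s₁ := {ω | Y ω ≤ b})
        (s₂ := {ω | X ω ≤ a ∧ Y ω ≤ b}) (fun ω hω => hω.2)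
        ((measurableSet_le hX measurable_const).inter (measurableSet_le hY measurable_const))
      have h' : P.real ({ω | Y ω ≤ b} \ {ω | X ω ≤ a ∧ Y ω ≤ b}) ≤ P.real {ω | a < X ω} :=
        measureReal_mono fun ω hω => not_le.1 fun h => hω.2 ⟨h, hω.1⟩
      have h3 := measure_gt_eq hX hF a
      have h4 := hJ a
      have h5 := hG b
      simp only [Measure.real] at h h'
      simp only
      linarith
    · simp only
      rw [← hJ a, ← hG b]
      exact measureReal_mono fun ω hω => hω.2
  exact tendsto_nhds_unique h2 h1

end Law

theorem abs_integral_sub_le_of_lipschitz_deriv {F u : ℝ → ℝ} {L : ℝ}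
    (hF : ∀ z, HasDerivAt F (u z) z) (hF1 : ∀ z, |F z| ≤ 1)
    (hL : ∀ z w, |u z - u w| ≤ L * |z - w|) (e b : ℝ) :
    |∫ z, F (b - e * z) ∂gaussianReal 0 1 - F b| ≤ L * e ^ 2 := by
  have hFc : Continuous F := continuous_iff_continuousAt.2 fun z => (hF z).continuousAt
  have hL0 : 0 ≤ L := by simpa using (abs_nonneg _).trans (hL 1 0)
  have i1 : Integrable (fun z => F (b - e * z)) (gaussianReal 0 1) :=
    Integrable.of_bound (by fun_prop) 1 (Eventually.of_forall fun z => hF1 _)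
  have i2 : Integrable (fun z : ℝ => u b * e * z) (gaussianReal 0 1) :=
    integrable_id_stdGaussian.const_mul _
  have i3 : Integrable (fun z => F (b - e * z) - F b) (gaussianReal 0 1) :=
    i1.sub (integrable_const _)
  have e1 : ∫ z, F (b - e * z) ∂gaussianReal 0 1 - F b
      = ∫ z, (F (b - e * z) - F b + u b * e * z) ∂gaussianReal 0 1 := by
    rw [integral_add i3 i2, integral_sub i1 (integrable_const _), integral_const_mul]
    simp
  rw [e1, ← Real.norm_eq_abs]
  refine (norm_integral_le_of_norm_le (integrable_sq_stdGaussian.const_mul (L * e ^ 2))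
    (Eventually.of_forall fun z => ?_)).trans_eq ?_
  · have h := abs_sub_le_of_hasDerivAt_of_abs_le (a := 0) (b := e * z) (C := L * |e * z|)
      (g := fun w => F (b - w) + u b * w) (g' := fun w => u b - u (b - w))
      (fun w _ => (((hF (b - w)).comp_const_sub b w).add
        ((hasDerivAt_id' w).const_mul (u b))).congr_deriv (by ring))
      (fun w hw => (hL _ _).trans (mul_le_mul_of_nonneg_left
        (by simpa using abs_le_of_mem_uIcc_zero hw) hL0))
    simp only [sub_zero, mul_zero, add_zero] at h
    rw [mul_assoc, abs_mul_abs_self] at h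
    rw [Real.norm_eq_abs]
    convert h using 1
    · congr 1
      ring
    · ring
  · rw [integral_const_mul, integral_sq_stdGaussian, mul_one]

theorem hasDerivAt_integral_Iic {u : ℝ → ℝ} (hu : Continuous u)
    (hi : ∀ a, IntegrableOn u (Iic a)) (a : ℝ) :
    HasDerivAt (fun r => ∫ x in Iic r, u x) (u a) a := by
  have h : (fun r => ∫ x in Iic r, u x) = fun r => (∫ x in Iic (0 : ℝ), u x) + ∫ x in 0..r, u x := by
    ext r
    rw [← intervalIntegral.integral_Iic_sub_Iic (hi 0) (hi r)]
    ring
  rw [h]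
  exact (intervalIntegral.integral_hasDerivAt_right (hu.intervalIntegrable _ _)
    (hu.stronglyMeasurableAtFilter _ _) hu.continuousAt).const_add _

theorem continuousOn_quantile {F : ℝ → ℝ → ℝ} {q : ℝ → ℝ} {α L : ℝ} (hL : 0 ≤ L)
    (hmono : ∀ t, 0 ≤ t → Monotone (F t)) (hq : ∀ t, 0 ≤ t → F t (q t) = α)
    (huniq : ∀ t, 0 ≤ t → ∀ r, F t r = α → r = q t)
    (hFt : ∀ s t, 0 ≤ s → 0 ≤ t → ∀ b, |F t b - F s b| ≤ L * |t - s|) :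
    ContinuousOn q (Ici 0) := by
  intro s hs
  rw [Metric.continuousWithinAt_iff]
  intro ε hε
  have h1 : F s (q s - ε) < α := by
    refine lt_of_le_of_ne (hq s hs ▸ hmono s hs (by linarith)) fun h => ?_
    have := huniq s hs _ h
    linarith
  have h2 : α < F s (q s + ε) := by
    refine lt_of_le_of_ne (hq s hs ▸ hmono s hs (by linarith)) fun h => ?_
    have := huniq s hs _ h.symm
    linarith
  set m := min (α - F s (q s - ε)) (F s (q s + ε) - α)
  have hm : 0 < m := lt_min (by linarith) (by linarith)
  have hL1 : 0 < L + 1 := by linarith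
  refine ⟨m / (L + 1), by positivity, fun t ht htd => ?_⟩
  rw [Real.dist_eq, lt_div_iff₀ hL1] at htd
  have hlt : L * |t - s| < m := by nlinarith [abs_nonneg (t - s)]
  have h3 := (abs_le.1 (hFt s t hs ht (q s - ε))).2
  have h4 := (abs_le.1 (hFt s t hs ht (q s + ε))).1
  have h5 : m ≤ α - F s (q s - ε) := min_le_left _ _
  have h6 : m ≤ F s (q s + ε) - α := min_le_right _ _
  have h7 := hq t ht
  rw [Real.dist_eq, abs_lt]
  constructor
  · by_contra! h
    have := hmono t ht (show q t ≤ q s - ε by linarith)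
    linarith
  · by_contra! h
    have := hmono t ht (show q s + ε ≤ q t by linarith)
    linarith

theorem exists_quantile_lipschitz {F u : ℝ → ℝ → ℝ} {q : ℝ → ℝ} {α L T : ℝ}
    (hmono : ∀ t, 0 ≤ t → Monotone (F t)) (hq : ∀ t, 0 ≤ t → F t (q t) = α)
    (huniq : ∀ t, 0 ≤ t → ∀ r, F t r = α → r = q t)
    (hF : ∀ t, 0 ≤ t → ∀ z, HasDerivAt (F t) (u t z) z)
    (hFt : ∀ s t, 0 ≤ s → 0 ≤ t → ∀ b, |F t b - F s b| ≤ L * |t - s|)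
    (hu : ∀ s t, 0 ≤ s → 0 ≤ t → ∀ x y, |u t x - u s y| ≤ L * (|x - y| + √|t - s|))
    (hpos : ∀ t, 0 ≤ t → 0 < u t (q t)) (hT : 0 ≤ T) :
    ∃ κ, 0 ≤ κ ∧ ∀ s t, 0 ≤ s → s < t → t ≤ T → |q t - q s| ≤ κ * (t - s) := by
  have hL : 0 ≤ L := by simpa using (abs_nonneg _).trans (hFt 0 1 le_rfl zero_le_one 0)
  have hqc : ContinuousOn q (Icc 0 T) :=
    (continuousOn_quantile hL hmono hq huniq hFt).mono fun t ht => ht.1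
  have huc : ContinuousOn (fun t => u t (q t)) (Icc 0 T) := by
    intro s hs
    rw [ContinuousWithinAt, tendsto_iff_dist_tendsto_zero]
    have h : Tendsto (fun t => L * (|q t - q s| + √|t - s|)) (𝓝[Icc 0 T] s)
        (𝓝 (L * (|q s - q s| + √|s - s|))) :=
      ((((hqc s hs).sub tendsto_const_nhds).abs).add
        (Real.continuous_sqrt.continuousAt.tendsto.comp
          ((tendsto_nhdsWithin_of_tendsto_nhds tendsto_id).sub tendsto_const_nhds).abs)).const_mul L
    simp only [sub_self, abs_zero, Real.sqrt_zero, add_zero, mul_zero] at h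
    refine squeeze_zero' (Eventually.of_forall fun t => dist_nonneg) ?_ h
    filter_upwards [self_mem_nhdsWithin] with t ht
    exact hu s t hs.1 ht.1 _ _
  obtain ⟨s₀, hs₀, hmin⟩ := isCompact_Icc.exists_isMinOn (nonempty_Icc.2 hT) huc
  set c := u s₀ (q s₀)
  have hc : 0 < c := hpos s₀ hs₀.1
  obtain ⟨R, hR⟩ := isCompact_Icc.exists_bound_of_continuousOn hqc
  have hR0 : 0 ≤ R := (norm_nonneg _).trans (hR 0 ⟨le_rfl, hT⟩)
  have hL1 : 0 < L + 1 := by linarith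
  obtain ⟨ρ, hρ, hunif⟩ := Metric.uniformContinuousOn_iff.1
    (isCompact_Icc.uniformContinuousOn_of_continuous hqc) (c / (2 * (L + 1))) (by positivity)
  refine ⟨2 * L / c + 2 * R / ρ, by positivity, fun s t hs hst htT => ?_⟩
  have ht : 0 ≤ t := hs.trans hst.le
  have hsI : s ∈ Icc 0 T := ⟨hs, hst.le.trans htT⟩
  have htI : t ∈ Icc 0 T := ⟨ht, htT⟩
  have hδ : 0 < t - s := sub_pos.2 hst
  rw [add_mul]
  have n1 : 0 ≤ 2 * L / c * (t - s) := by positivity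
  have n2 : 0 ≤ 2 * R / ρ * (t - s) := by positivity
  rcases lt_or_ge (t - s) ρ with hlt | hge
  · have hd : |q t - q s| < c / (2 * (L + 1)) :=
      hunif t htI s hsI (by rwa [Real.dist_eq, abs_of_pos hδ])
    rw [lt_div_iff₀ (by positivity)] at hd
    have hLd : L * |q t - q s| ≤ c / 2 := by nlinarith [abs_nonneg (q t - q s)]
    have h1 := abs_sub_le_of_hasDerivAt_of_abs_le (a := q s) (b := q t)
      (C := L * |q t - q s|) (g := fun w => F s w - u s (q s) * w)
      (g' := fun w => u s w - u s (q s))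
      (fun w _ => ((hF s hs w).sub
        ((hasDerivAt_id' w).const_mul (u s (q s)))).congr_deriv (by ring))
      (fun w hw => by
        have := hu s s hs hs w (q s)
        simp only [sub_self, abs_zero, Real.sqrt_zero, add_zero] at this
        exact this.trans (mul_le_mul_of_nonneg_left (abs_sub_left_of_mem_uIcc hw) hL))
    have h2 := hFt s t hs ht (q t)
    rw [hq t ht, abs_of_pos hδ] at h2
    have hcs : c ≤ u s (q s) := hmin hsI
    have h3 : c * |q t - q s| ≤ |u s (q s) * (q t - q s)| := by
      rw [abs_mul]
      exact mul_le_mul_of_nonneg_right (hcs.trans (le_abs_self _)) (abs_nonneg _)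
    have h4 : |u s (q s) * (q t - q s)| ≤ L * (t - s) + c / 2 * |q t - q s| := by
      have e : u s (q s) * (q t - q s)
          = -(α - F s (q t)) - (F s (q t) - u s (q s) * q t - (F s (q s) - u s (q s) * q s)) := by
        rw [hq s hs]
        ring
      rw [e]
      refine (abs_sub _ _).trans ?_
      rw [abs_neg]
      exact add_le_add h2 (h1.trans (mul_le_mul_of_nonneg_right hLd (abs_nonneg _)))
    have h5 : |q t - q s| ≤ 2 * L / c * (t - s) := by
      rw [div_mul_eq_mul_div, le_div_iff₀ hc]
      linarith
    linarith
  · have h1 : |q t - q s| ≤ 2 * R := by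
      have h2 := hR t htI
      have h3 := hR s hsI
      rw [Real.norm_eq_abs] at h2 h3
      linarith [abs_sub (q t) (q s)]
    have h2 : 2 * R ≤ 2 * R / ρ * (t - s) := by
      rw [div_mul_eq_mul_div, le_div_iff₀ hρ]
      exact mul_le_mul_of_nonneg_left hge (by positivity)
    linarith

/-- Replacing `α` by a nearby `β` in a conditional probability changes it by `O(|α - β|)`. -/
theorem abs_mul_div_sub_le {α β p η : ℝ} (hα : 0 < α) (hp : 0 ≤ p) (hβ : |β - α| ≤ η)
    (hη : η ≤ α / 2) : |α * (p / β) - p| ≤ p * η * (2 / α) := by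
  have hβ2 : α / 2 ≤ β := by linarith [(abs_le.1 hβ).1]
  have hβ0 : 0 < β := by linarith
  have e : α * (p / β) - p = -(p * (β - α)) / β := by field_simp; ring
  have hη0 : 0 ≤ η := (abs_nonneg _).trans hβ
  rw [e, abs_div, abs_neg, abs_mul, abs_of_nonneg hp, abs_of_pos hβ0, div_le_iff₀ hβ0]
  calc p * |β - α| ≤ p * η := by gcongr
    _ = p * η * (2 / α) * (α / 2) := by field_simp
    _ ≤ p * η * (2 / α) * β := by gcongr

/-- Expansion of the increment of two nearby distribution functions started at a common level. -/
theorem abs_distribution_increment_sub_le {F G u v : ℝ → ℝ} {L e d a b α x y : ℝ} (he : 0 ≤ e)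
    (hF : ∀ z, HasDerivAt F (u z) z) (hG : ∀ z, HasDerivAt G (v z) z) (hL : 0 ≤ L)
    (huv : ∀ z w, |v z - u w| ≤ L * (|z - w| + e)) (hFa : F a = α) (hGb : G b = α)
    (hab : b - a = d) :
    |G (b + x + y) - F (a + x) - u a * y| ≤ 2 * L * (|x| + |y|) * (e + |d| + |y|) := by
  have h1 := abs_sub_le_of_hasDerivAt_of_abs_le (a := 0) (b := x) (C := L * (|d| + e))
    (g := fun w => G (b + w) - F (a + w)) (g' := fun w => v (b + w) - u (a + w))
    (fun w _ => ((hG (b + w)).comp_const_add b w).sub ((hF (a + w)).comp_const_add a w))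
    (fun w _ => by simpa [hab] using huv (b + w) (a + w))
  have h2 := abs_sub_le_of_hasDerivAt_of_abs_le (a := 0) (b := y) (C := L * (|d| + |x| + |y| + e))
    (g := fun w => G (b + x + w) - u a * w) (g' := fun w => v (b + x + w) - u a)
    (fun w _ => (((hG (b + x + w)).comp_const_add (b + x) w).sub
      ((hasDerivAt_id' w).const_mul (u a))).congr_deriv (by ring))
    (fun w hw => by
      refine (huv _ _).trans (mul_le_mul_of_nonneg_left ?_ hL)
      have e1 : b + x + w - a = d + x + w := by rw [← hab]; ring
      rw [e1]
      linarith [abs_add_le (d + x) w, abs_add_le d x, abs_le_of_mem_uIcc_zero hw])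
  simp only [add_zero, mul_zero, sub_zero, hFa, hGb, sub_self] at h1 h2
  have e2 : G (b + x + y) - F (a + x) - u a * y
      = (G (b + x) - F (a + x)) + (G (b + x + y) - u a * y - G (b + x)) := by ring
  rw [e2]
  refine (abs_add_le _ _).trans ((add_le_add h1 h2).trans ?_)
  have h3 : 0 ≤ L * |x| * (e + |d| + |y|) := by positivity
  have h4 : 0 ≤ L * |y| * (e + |d| + |y|) := by positivity
  linarith

theorem abs_mul_div_sub_le_of_abs_sub_le {α β p m M c c₁ r w N : ℝ} (hα : 0 < α) (hM : 0 ≤ M)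
    (hc : 0 ≤ c) (hp : 0 ≤ p) (hpw : p ≤ c * w) (hβ : |β - α| ≤ M * r) (hr : M * r ≤ α / 2)
    (hrw : r * w ≤ N) (hm : |p - m| ≤ c₁ * N) :
    |α * (p / β) - m| ≤ (c * M * (2 / α) + c₁) * N := by
  have h1 := abs_mul_div_sub_le hα hp hβ hr
  have hr0 : 0 ≤ M * r := (abs_nonneg _).trans hβ
  have h2 : p * (M * r) * (2 / α) ≤ c * M * (2 / α) * N := by
    calc p * (M * r) * (2 / α) ≤ c * w * (M * r) * (2 / α) := by gcongr
      _ = c * M * (2 / α) * (r * w) := by ring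
      _ ≤ c * M * (2 / α) * N := by gcongr
  have h3 := abs_sub_le (α * (p / β)) p m
  linarith

theorem exists_schwartzMap_lipschitz (f : SchwartzMap ℝ ℝ) :
    ∃ L, ∀ z w, |f z - f w| ≤ L * |z - w| := by
  refine ⟨SchwartzMap.seminorm ℝ 0 1 f, fun z w => ?_⟩
  refine abs_sub_le_of_hasDerivAt_of_abs_le (g' := deriv f)
    (fun v _ => f.differentiableAt.hasDerivAt) fun v _ => ?_
  simpa using SchwartzMap.le_seminorm' ℝ 0 1 f v

theorem integrableOn_Iic_of_monotone_integral {u : ℝ → ℝ} {r : ℝ}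
    (hmono : Monotone fun a => ∫ x in Iic a, u x) (hr : 0 < ∫ x in Iic r, u x) (a : ℝ) :
    IntegrableOn u (Iic a) := by
  have h : IntegrableOn u (Iic (max a r)) := by
    by_contra h
    have h1 : (∫ x in Iic r, u x) ≤ ∫ x in Iic (max a r), u x := hmono (le_max_right a r)
    rw [integral_undef h] at h1
    exact absurd hr (not_lt.2 h1)
  exact h.mono_set (Iic_subset_Iic.2 (le_max_left a r))

theorem abs_udens_sub_le_of_nonneg {f : ℝ → ℝ} (hf : Continuous f) {M L : ℝ}
    (hM : ∀ z, |f z| ≤ M) (hL : ∀ z w, |f z - f w| ≤ L * |z - w|) (s t : ℝ) (hs : 0 ≤ s)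
    (ht : 0 ≤ t) (x y : ℝ) : |udens f x t - udens f y s| ≤ L * (|x - y| + √|t - s|) := by
  rcases le_total s t with h | h
  · rw [abs_of_nonneg (sub_nonneg.2 h)]
    exact abs_udens_sub_le hf hM hL hs h x y
  · rw [abs_sub_comm, abs_sub_comm x, abs_sub_comm t, abs_of_nonneg (sub_nonneg.2 h)]
    exact abs_udens_sub_le hf hM hL ht h y x

theorem rpow_neg_div_eq_inv_sqrt {δ : ℝ} (hδ : 0 < δ) : δ ^ (-(1 : ℝ) / 2) = (√δ)⁻¹ := by
  rw [neg_div, Real.rpow_neg hδ.le, ← Real.sqrt_eq_rpow]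

theorem rpow_neg_three_div_eq_inv_sqrt {δ : ℝ} (hδ : 0 < δ) :
    δ ^ (-(3 : ℝ) / 2) = (√δ ^ 3)⁻¹ := by
  rw [neg_div, Real.rpow_neg hδ.le, Real.sqrt_eq_rpow, ← Real.rpow_natCast, ← Real.rpow_mul hδ.le]
  norm_num

end

/-- Taylor expansions of `αq₁` and `(1−α)q₂`. For `0 ≤ s < t ≤ T`,
`|x| + |y| ≤ K` and `|x| ≤ δ₀`:
`αq₁(x,y) = Ψ(0,0) − (1/2)u(q(s),s)y + (2√(2πδ))⁻¹u(q(s),s)y² + R₁` and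
`(1−α)q₂(x,y) = Ψ(0,0) + (1/2)u(q(s),s)y + (2√(2πδ))⁻¹u(q(s),s)y² + R₂`, where both
remainders satisfy `|Rᵢ| ≤ C((|x|+|y|)(δ^{1/2} + |y| + δ^{-1/2}|y|²) + δ^{-3/2}|y|⁴)`. -/
theorem q_one_q_two_taylor
    {Ω : Type*} [MeasurableSpace Ω] (P : Measure Ω) [IsProbabilityMeasure P]
    (f : SchwartzMap ℝ ℝ) (hf_nonneg : ∀ x, 0 ≤ f x) (hf_prob : ∫ x : ℝ, f x = 1)
    (α : ℝ) (hα : α ∈ Set.Ioo (0 : ℝ) 1)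
    (q : ℝ → ℝ)
    (hq : ∀ t, 0 ≤ t → ∫ x in Set.Iic (q t), udens (⇑f) x t = α)
    (hq_unique : ∀ t, 0 ≤ t → ∀ r : ℝ, (∫ x in Set.Iic r, udens (⇑f) x t = α) → r = q t)
    (hfq0 : 0 < f (q 0))
    (B : ℝ → Ω → ℝ) (hB_meas : ∀ t, Measurable (B t))
    (hBmarg : ∀ t, 0 ≤ t → ∀ a : ℝ,
      (P {ω | B t ω ≤ a}).toReal = ∫ x in Set.Iic a, udens (⇑f) x t)
    (hBjoint : ∀ s t : ℝ, 0 ≤ s → s < t → ∀ a b : ℝ,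
      (P {ω | B s ω ≤ a ∧ B t ω ≤ b}).toReal
        = ∫ x in Set.Iic a, (∫ y in Set.Iic b, heatKernel (t - s) x y) * udens (⇑f) x s)
    (T K : ℝ) (hT : 0 < T) (hK : 0 < K) :
    ∃ δ₀ > (0 : ℝ), ∃ C : ℝ, ∀ s t x y : ℝ, 0 ≤ s → s < t → t ≤ T → |x| + |y| ≤ K →
      |x| ≤ δ₀ →
      (∃ R₁ : ℝ,
        α * qOneB P B q s t x y
            = bigPsi P B q s t 0 0 - 1 / 2 * udens (⇑f) (q s) s * y
            + 1 / (2 * Real.sqrt (2 * Real.pi * (t - s))) * udens (⇑f) (q s) s * y ^ 2 + R₁ ∧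
          |R₁| ≤ C * ((|x| + |y|) * ((t - s) ^ ((1 : ℝ) / 2) + |y| + (t - s) ^ (-(1 : ℝ) / 2) * |y| ^ 2)
              + (t - s) ^ (-(3 : ℝ) / 2) * |y| ^ 4)) ∧
      (∃ R₂ : ℝ,
        (1 - α) * qTwoB P B q s t x y
            = bigPsi P B q s t 0 0 + 1 / 2 * udens (⇑f) (q s) s * y
              + 1 / (2 * Real.sqrt (2 * Real.pi * (t - s))) * udens (⇑f) (q s) s * y ^ 2 + R₂ ∧
          |R₂| ≤ C * ((|x| + |y|) * ((t - s) ^ ((1 : ℝ) / 2) + |y| + (t - s) ^ (-(1 : ℝ) / 2) * |y| ^ 2)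
              + (t - s) ^ (-(3 : ℝ) / 2) * |y| ^ 4)) := by
  obtain ⟨M, hM⟩ : ∃ M, ∀ z, |f z| ≤ M := ⟨_, SchwartzMap.norm_le_seminorm ℝ f⟩
  obtain ⟨L, hL⟩ := exists_schwartzMap_lipschitz f
  have hM0 : 0 ≤ M := (abs_nonneg _).trans (hM 0)
  have hL0 : 0 ≤ L := by simpa using (abs_nonneg _).trans (hL 1 0)
  obtain ⟨hα0, hα1⟩ := hα
  set F : ℝ → ℝ → ℝ := fun t r => ∫ x in Iic r, udens f x t with hFdef
  have hlaw : ∀ t, 0 ≤ t → ∀ a, (P {ω | B t ω ≤ a}).toReal = F t a := hBmarg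
  have hint : ∀ t, 0 ≤ t → ∀ a, IntegrableOn (fun x => udens f x t) (Iic a) :=
    fun t ht => integrableOn_Iic_of_monotone_integral (distribution_monotone (hlaw t ht))
      (by rw [hq t ht]; exact hα0)
  have husymm := abs_udens_sub_le_of_nonneg f.continuous hM hL
  have huL : ∀ t, 0 ≤ t → ∀ z w, |udens f z t - udens f w t| ≤ L * |z - w| := fun t ht z w => by
    simpa using husymm t t ht ht z w
  have hucont : ∀ t, 0 ≤ t → Continuous fun x => udens f x t := fun t ht =>
    (LipschitzWith.of_dist_le_mul (K := ⟨L, hL0⟩) (huL t ht)).continuous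
  have hF : ∀ t, 0 ≤ t → ∀ z, HasDerivAt (F t) (udens f z t) z := fun t ht =>
    hasDerivAt_integral_Iic (hucont t ht) (hint t ht)
  have hFc : ∀ t, 0 ≤ t → Continuous (F t) := fun t ht =>
    continuous_iff_continuousAt.2 fun z => (hF t ht z).continuousAt
  have hF1 : ∀ t, 0 ≤ t → ∀ z, |F t z| ≤ 1 := fun t ht => abs_distribution_le_one (hlaw t ht)
  have hJ : ∀ s t, 0 ≤ s → s < t → ∀ a b, (P {ω | B s ω ≤ a ∧ B t ω ≤ b}).toReal
      = ∫ z, F s (min a (b - √(t - s) * z)) ∂ProbabilityTheory.gaussianReal 0 1 := fun s t hs hst a b => by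
    rw [hBjoint s t hs hst, integral_Iic_heatKernel_mul (hint s hs) (sub_pos.2 hst)]
  have hFt_lt : ∀ s t, 0 ≤ s → s < t → ∀ b, |F t b - F s b| ≤ L * (t - s) := by
    intro s t hs hst b
    rw [distribution_eq_integral (hB_meas s) (hB_meas t) (hlaw s hs) (hFc s hs)
      (hlaw t (hs.trans hst.le)) (√(t - s)) b fun a => hJ s t hs hst a b]
    have h := abs_integral_sub_le_of_lipschitz_deriv (hF s hs) (hF1 s hs) (huL s hs) (√(t - s)) b
    rwa [Real.sq_sqrt (sub_nonneg.2 hst.le)] at h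
  have hFt : ∀ s t, 0 ≤ s → 0 ≤ t → ∀ b, |F t b - F s b| ≤ L * |t - s| := by
    intro s t hs ht b
    rcases lt_trichotomy s t with h | rfl | h
    · rw [abs_of_pos (sub_pos.2 h)]
      exact hFt_lt s t hs h b
    · simp
    · rw [abs_sub_comm, abs_sub_comm t, abs_of_pos (sub_pos.2 h)]
      exact hFt_lt t s ht h b
  have hupos : ∀ t, 0 ≤ t → 0 < udens f (q t) t := fun t ht => by
    rcases ht.eq_or_lt with rfl | ht
    · simpa [udens] using hfq0
    · exact udens_pos f.continuous hf_nonneg hM hfq0 ht _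
  obtain ⟨κ, hκ, hqκ⟩ := exists_quantile_lipschitz (u := fun t x => udens f x t)
    (fun t ht => distribution_monotone (hlaw t ht)) hq hq_unique hF hFt husymm hupos hT.le
  have hβ : 0 < min α (1 - α) := lt_min hα0 (by linarith)
  set c := M * (1 + κ * √T) + 2 * L * K * (1 + κ * √T) + M with hc
  set C₁ := 2 * L * (1 + κ * √T) + M * κ + M with hC₁
  have hc0 : 0 ≤ c := by positivity
  have hC₁0 : 0 ≤ C₁ := by positivity
  have hα' : 0 < 1 - α := by linarith
  refine ⟨min α (1 - α) / (2 * (M + 1)), by positivity,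
    c * M * (2 / α) + c * M * (2 / (1 - α)) + (C₁ + 2 * L * (1 + κ * √T)), ?_⟩
  intro s t x y hs hst htT hxy hx
  have ht : 0 ≤ t := hs.trans hst.le
  have hδ : 0 < t - s := sub_pos.2 hst
  have hd := hqκ s t hs hst htT
  rw [Real.sqrt_mul (by positivity), rpow_neg_div_eq_inv_sqrt hδ,
    rpow_neg_three_div_eq_inv_sqrt hδ, ← Real.sqrt_eq_rpow]
  set e := √(t - s) with he_def
  have he : 0 < e := Real.sqrt_pos.2 hδ
  have heT : e ≤ √T := Real.sqrt_le_sqrt (by linarith)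
  rw [← Real.sq_sqrt hδ.le, ← he_def] at hd
  set d := q t - q s with hd_def
  set u := udens f (q s) s with hu_def
  have hdw : e + |d| + |y| ≤ (1 + κ * √T) * (e + |y|) := by
    have h1 : κ * e ^ 2 ≤ κ * √T * e := by
      rw [sq, ← mul_assoc]
      gcongr
    have h2 : 0 ≤ κ * √T * |y| := by positivity
    linarith
  have hx' : M * |x| ≤ min α (1 - α) / 2 := by
    rw [le_div_iff₀ (by positivity)] at hx
    linarith [abs_nonneg x]
  have hxα : M * |x| ≤ α / 2 := by linarith [min_le_left α (1 - α)]
  have hxα' : M * |x| ≤ (1 - α) / 2 := by linarith [min_le_right α (1 - α)]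
  have hup : ∀ x y, (P {ω | q t + x + y < B t ω ∧ B s ω < q s + x}).toReal
      = crossing (F s) e (q s + x) (y + d) := fun x y => by
    rw [measure_up_crossing_eq (hB_meas s) (hB_meas t) (hlaw s hs) (hFc s hs), hJ s t hs hst,
      distribution_sub_integral_eq_crossing (hFc s hs) (hF1 s hs)]
    congr 1
    rw [hd_def]
    ring
  have hdown : (P {ω | B t ω < q t + x + y ∧ q s + x < B s ω}).toReal
      = F t (q t + x + y) - F s (q s + x)
        + (P {ω | q t + x + y < B t ω ∧ B s ω < q s + x}).toReal := by
    rw [measure_up_crossing_eq (hB_meas s) (hB_meas t) (hlaw s hs) (hFc s hs),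
      measure_down_crossing_eq (hB_meas s) (hB_meas t) (hlaw t ht) (hFc t ht)]
    ring
  have hΨ₀ : bigPsi P B q s t 0 0 = crossing (F s) e (q s) d := by
    rw [bigPsi, hup, add_zero, zero_add]
  have hΨnn : 0 ≤ crossing (F s) e (q s + x) (y + d) := by
    rw [← hup]
    exact ENNReal.toReal_nonneg
  have hΨle : crossing (F s) e (q s + x) (y + d) ≤ M * (1 + κ * √T) * (e + |y|) := by
    refine (crossing_le (hF s hs) (hF1 s hs) (fun z => abs_udens_le f.continuous hM hs z) he
      _ _).trans ?_
    rw [mul_assoc]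
    refine mul_le_mul_of_nonneg_left ?_ hM0
    linarith [abs_add_le y d]
  have hΨ := abs_crossing_sub_taylor_le (hF s hs) (hF1 s hs)
    (fun z => abs_udens_le f.continuous hM hs z) (huL s hs) hκ he heT hd (q s) x y
  have hD := abs_distribution_increment_sub_le (x := x) (y := y) he.le (hF s hs) (hF t ht) hL0
    (fun z w => by simpa [abs_of_pos hδ] using husymm s t hs ht z w) (hq s hs) (hq t ht)
    hd_def.symm
  rw [← hu_def] at hΨ hD
  rw [← hC₁] at hΨ
  have hFx : |F s (q s + x) - α| ≤ M * |x| := by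
    have h := abs_sub_le_of_hasDerivAt_of_abs_le (a := q s) (b := q s + x)
      (fun w _ => hF s hs w) (fun w _ => abs_udens_le f.continuous hM hs w)
    rwa [add_sub_cancel_left, show F s (q s) = α from hq s hs] at h
  set N := (|x| + |y|) * (e + |y|) + |y| ^ 4 / e ^ 3 with hN
  have hq0 : 0 ≤ |y| ^ 4 / e ^ 3 := by positivity
  have hN0 : 0 ≤ N := by positivity
  have hsum : (|x| + |y|) * (e + |y|) ≤ N := by linarith
  have hxN : |x| * (e + |y|) ≤ N := by
    have : 0 ≤ |y| * (e + |y|) := by positivity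
    linarith
  have hNle : N ≤ (|x| + |y|) * (e + |y| + e⁻¹ * |y| ^ 2) + (e ^ 3)⁻¹ * |y| ^ 4 := by
    have : 0 ≤ (|x| + |y|) * (e⁻¹ * |y| ^ 2) := by positivity
    rw [hN, div_eq_inv_mul]
    linarith
  have hw0 : 0 ≤ e + |y| := by positivity
  have hDN : |F t (q t + x + y) - F s (q s + x) - u * y|
      ≤ 2 * L * (1 + κ * √T) * ((|x| + |y|) * (e + |y|)) := by
    refine hD.trans ?_
    have := mul_le_mul_of_nonneg_left hdw (show 0 ≤ 2 * L * (|x| + |y|) by positivity)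
    linarith
  have hLκ : 0 ≤ 2 * L * (1 + κ * √T) := by positivity
  have hcα : 0 ≤ c * M * (2 / α) * N := by positivity
  have hcα' : 0 ≤ c * M * (2 / (1 - α)) * N := by positivity
  have hLN : 0 ≤ 2 * L * (1 + κ * √T) * N := by positivity
  have hCpos : 0 ≤ c * M * (2 / α) + c * M * (2 / (1 - α)) + (C₁ + 2 * L * (1 + κ * √T)) := by
    positivity
  refine ⟨⟨_, (add_sub_cancel _ _).symm, ?_⟩, ⟨_, (add_sub_cancel _ _).symm, ?_⟩⟩
  · refine le_trans ?_ (mul_le_mul_of_nonneg_left hNle hCpos)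
    rw [qOneB, hup, measure_lt_eq (hB_meas s) (hlaw s hs) (hFc s hs), hΨ₀]
    have hle : crossing (F s) e (q s + x) (y + d) ≤ c * (e + |y|) := by
      refine hΨle.trans (mul_le_mul_of_nonneg_right ?_ hw0)
      have : 0 ≤ 2 * L * K * (1 + κ * √T) := by positivity
      linarith
    refine (abs_mul_div_sub_le_of_abs_sub_le hα0 hM0 hc0 hΨnn hle hFx hxα hxN
      ((le_of_eq ?_).trans hΨ)).trans ?_
    · congr 1
      ring
    · linarith
  · refine le_trans ?_ (mul_le_mul_of_nonneg_left hNle hCpos)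
    have hnn : 0 ≤ (P {ω | B t ω < q t + x + y ∧ q s + x < B s ω}).toReal :=
      ENNReal.toReal_nonneg
    rw [hdown, hup] at hnn
    rw [qTwoB, hdown, hup, measure_gt_eq (hB_meas s) (hlaw s hs), hΨ₀]
    have hle : F t (q t + x + y) - F s (q s + x) + crossing (F s) e (q s + x) (y + d)
        ≤ c * (e + |y|) := by
      have h1 : u * y ≤ M * |y| := (le_abs_self _).trans (by
        rw [abs_mul]
        exact mul_le_mul_of_nonneg_right (abs_udens_le f.continuous hM hs _) (abs_nonneg _))
      have h2 : 2 * L * (1 + κ * √T) * ((|x| + |y|) * (e + |y|))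
          ≤ 2 * L * (1 + κ * √T) * (K * (e + |y|)) := by gcongr
      have h3 := (abs_le.1 hDN).2
      have h4 : 0 ≤ M * e := by positivity
      rw [hc]
      linarith
    have hFx' : |1 - F s (q s + x) - (1 - α)| ≤ M * |x| := by
      rw [sub_sub_sub_cancel_left, abs_sub_comm]
      exact hFx
    refine (abs_mul_div_sub_le_of_abs_sub_le hα' hM0 hc0 hnn hle hFx' hxα' hxN
      (c₁ := C₁ + 2 * L * (1 + κ * √T)) ?_).trans ?_
    · have h1 := mul_le_mul_of_nonneg_left hsum hLκ
      have h2 := abs_add_le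
        (crossing (F s) e (q s + x) (y + d)
          - (crossing (F s) e (q s) d + u * (-(1 / 2) * y + 1 / (2 * (√(2 * π) * e)) * y ^ 2)))
        (F t (q t + x + y) - F s (q s + x) - u * y)
      refine (le_of_eq ?_).trans (h2.trans (by linarith))
      congr 1
      ring
    · linarith
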